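/- For all Boolean normal monotonic (BNM) schemes 𝕏, 𝕏', 𝕏'', the transitive closure of the union of the ss-valid and tt-valid inferences equals the set of st-valid inferences: T(SS(𝕏) ∪ TT(𝕏')) = ST(𝕏''). -/

import Mathlib

namespace ThreeValued

/-- Formulas of the propositional language: countably many variables,
negation, conjunction, disjunction. -/
inductive Fml : Type
  | var : ℕ → Fml
  | neg : Fml → Fml
  | conj : Fml → Fml → Fml
  | disj : Fml → Fml → Fml
deriving DecidableEq

/-- An inference Γ ⇒ φ: a finite set of premises and a conclusion. -/
structure Infer : Type where
  prem : Finset Fml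
  concl : Fml

/-- A set of inferences is closed under transitivity:
whenever there is a nonempty Δ with Δ ⇒ φ ∈ L and Γ ⇒ δ ∈ L for all δ ∈ Δ,
then Γ ⇒ φ ∈ L. -/
def TransClosed (L : Set Infer) : Prop :=
  ∀ (Γ Δ : Finset Fml) (φ : Fml), Δ.Nonempty →
    (⟨Δ, φ⟩ : Infer) ∈ L → (∀ δ ∈ Δ, (⟨Γ, δ⟩ : Infer) ∈ L) → (⟨Γ, φ⟩ : Infer) ∈ L

/-- The transitive closure of a set of inferences: the least superset closed
under transitivity. -/
def T (L : Set Infer) : Set Infer := ⋂₀ {L' : Set Infer | L ⊆ L' ∧ TransClosed L'}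

/-- A set of inferences is open under dual transitivity:
whenever there is a nonempty Δ with Δ ⇒ φ ∉ L and Γ ⇒ δ ∉ L for all δ ∈ Δ,
then Γ ⇒ φ ∉ L. -/
def DualTransClosed (L : Set Infer) : Prop :=
  ∀ (Γ Δ : Finset Fml) (φ : Fml), Δ.Nonempty →
    (⟨Δ, φ⟩ : Infer) ∉ L → (∀ δ ∈ Δ, (⟨Γ, δ⟩ : Infer) ∉ L) → (⟨Γ, φ⟩ : Infer) ∉ L

/-- The dual transitive closure: the greatest subset open under dual
transitivity. -/
def Td (L : Set Infer) : Set Infer := ⋃₀ {L' : Set Infer | L' ⊆ L ∧ DualTransClosed L'}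

/-- The three truth values 0, 1/2, 1. -/
inductive V3 : Type
  | zero | half | one
deriving DecidableEq

/-- A three-valued scheme: a triple of truth functions for ¬, ∧ and ∨. -/
structure Scheme : Type where
  fneg : V3 → V3
  fconj : V3 → V3 → V3
  fdisj : V3 → V3 → V3

/-- Boolean normality: on Boolean inputs the operations agree with the
classical ones. -/
def BooleanNormal (X : Scheme) : Prop :=
  X.fneg .zero = .one ∧ X.fneg .one = .zero ∧
  X.fconj .one .one = .one ∧ X.fconj .one .zero = .zero ∧
  X.fconj .zero .one = .zero ∧ X.fconj .zero .zero = .zero ∧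
  X.fdisj .one .one = .one ∧ X.fdisj .one .zero = .one ∧
  X.fdisj .zero .one = .one ∧ X.fdisj .zero .zero = .zero

/-- The information order: 1/2 is below 0 and below 1. -/
def infLe (a b : V3) : Prop := a = .half ∨ a = b

/-- Monotonicity of a scheme with respect to the information order. -/
def Monotonic (X : Scheme) : Prop :=
  (∀ a b, infLe a b → infLe (X.fneg a) (X.fneg b)) ∧
  (∀ a₁ a₂ b₁ b₂, infLe a₁ b₁ → infLe a₂ b₂ → infLe (X.fconj a₁ a₂) (X.fconj b₁ b₂)) ∧
  (∀ a₁ a₂ b₁ b₂, infLe a₁ b₁ → infLe a₂ b₂ → infLe (X.fdisj a₁ a₂) (X.fdisj b₁ b₂))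

/-- Boolean normal monotonic schemes. -/
def BNM (X : Scheme) : Prop := BooleanNormal X ∧ Monotonic X

/-- Valuations respecting a scheme. -/
def Respects (X : Scheme) (v : Fml → V3) : Prop :=
  (∀ φ, v (.neg φ) = X.fneg (v φ)) ∧
  (∀ φ ψ, v (.conj φ ψ) = X.fconj (v φ) (v ψ)) ∧
  (∀ φ ψ, v (.disj φ ψ) = X.fdisj (v φ) (v ψ))

/-- The strict formula-standard s = {1}. -/
def sStd : Set V3 := {.one}

/-- The tolerant formula-standard t = {1, 1/2}. -/
def tStd : Set V3 := {.one, .half}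

/-- An inference is xy-valid over a scheme X if every valuation respecting X
whose value on each premise is in x gives the conclusion a value in y. -/
def Valid (X : Scheme) (x y : Set V3) (I : Infer) : Prop :=
  ∀ v : Fml → V3, Respects X v → (∀ γ ∈ I.prem, v γ ∈ x) → v I.concl ∈ y

/-- The ss-valid inferences over X. -/
def SS (X : Scheme) : Set Infer := {I | Valid X sStd sStd I}

/-- The tt-valid inferences over X. -/
def TT (X : Scheme) : Set Infer := {I | Valid X tStd tStd I}

/-- The st-valid inferences over X. -/
def ST (X : Scheme) : Set Infer := {I | Valid X sStd tStd I}

/-- The ts-valid inferences over X. -/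
def TS (X : Scheme) : Set Infer := {I | Valid X tStd sStd I}

/-- Classical two-valued valuations. -/
def RespectsCL (v : Fml → Bool) : Prop :=
  (∀ φ, v (.neg φ) = ! v φ) ∧
  (∀ φ ψ, v (.conj φ ψ) = (v φ && v ψ)) ∧
  (∀ φ ψ, v (.disj φ ψ) = (v φ || v ψ))

/-- The classically valid inferences. -/
def CL : Set Infer :=
  {I | ∀ v : Fml → Bool, RespectsCL v → (∀ γ ∈ I.prem, v γ = true) → v I.concl = true}

/-- Substitution: the homomorphic extension of a map from variables to
formulas. -/
def subst (σ : ℕ → Fml) : Fml → Fml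
  | .var n => σ n
  | .neg φ => .neg (subst σ φ)
  | .conj φ ψ => .conj (subst σ φ) (subst σ ψ)
  | .disj φ ψ => .disj (subst σ φ) (subst σ ψ)

/-- Reflexivity. -/
def PropR (L : Set Infer) : Prop := ∀ φ : Fml, (⟨{φ}, φ⟩ : Infer) ∈ L

/-- Monotonicity (weakening). -/
def PropM (L : Set Infer) : Prop :=
  ∀ (Γ Sg : Finset Fml) (φ : Fml), (⟨Γ, φ⟩ : Infer) ∈ L → Γ ⊆ Sg → (⟨Sg, φ⟩ : Infer) ∈ L

/-- Structurality (closure under substitutions). -/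
def PropS (L : Set Infer) : Prop :=
  ∀ (Γ : Finset Fml) (φ : Fml), (⟨Γ, φ⟩ : Infer) ∈ L →
    ∀ σ : ℕ → Fml, (⟨Γ.image (subst σ), subst σ φ⟩ : Infer) ∈ L

/-- The Tarskian closure: the least superset satisfying (R), (M), (T), (S). -/
def Tar (L : Set Infer) : Set Infer :=
  ⋂₀ {L' : Set Infer | L ⊆ L' ∧ PropR L' ∧ PropM L' ∧ TransClosed L' ∧ PropS L'}

/-- L⋆: the inferences whose premise set is an antitheorem of L or whose
conclusion is a theorem of L. -/
def starL (L : Set Infer) : Set Infer :=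
  {I | (∀ ψ : Fml, (⟨I.prem, ψ⟩ : Infer) ∈ L) ∨ (∀ Δ : Finset Fml, (⟨Δ, I.concl⟩ : Infer) ∈ L)}

/-- The propositional variables occurring in a formula. -/
def fvars : Fml → Finset ℕ
  | .var n => {n}
  | .neg φ => fvars φ
  | .conj φ ψ => fvars φ ∪ fvars ψ
  | .disj φ ψ => fvars φ ∪ fvars ψ

/-- The embedding of the classical truth values into the three values. -/
def ofBool : Bool → V3
  | true => .one
  | false => .zero

/-- The classical valuation extending a Boolean assignment to the variables. -/
def evalBool (a : ℕ → Bool) : Fml → Bool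
  | .var n => a n
  | .neg φ => ! evalBool a φ
  | .conj φ ψ => evalBool a φ && evalBool a ψ
  | .disj φ ψ => evalBool a φ || evalBool a ψ

/-- The iterated material conditional `¬γ₁ ∨ (¬γ₂ ∨ ⋯ ∨ φ)`. -/
def imps (l : List Fml) (φ : Fml) : Fml :=
  l.foldr (fun γ χ => .disj (.neg γ) χ) φ

theorem respectsCL_evalBool (a : ℕ → Bool) : RespectsCL (evalBool a) :=
  ⟨fun _ => rfl, fun _ _ => rfl, fun _ _ => rfl⟩

/-- A classical valuation respects every Boolean normal scheme. -/
theorem BooleanNormal.respects_ofBool {X : Scheme} (hX : BooleanNormal X) {w : Fml → Bool}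
    (hw : RespectsCL w) : Respects X (fun φ => ofBool (w φ)) := by
  obtain ⟨n0, n1, c11, c10, c01, c00, d11, d10, d01, d00⟩ := hX
  obtain ⟨hn, hc, hd⟩ := hw
  refine ⟨fun φ => ?_, fun φ ψ => ?_, fun φ ψ => ?_⟩
  · cases h : w φ <;> simp [hn, h, ofBool, n0, n1]
  · cases h : w φ <;> cases h' : w ψ <;> simp [hc, h, h', ofBool, c11, c10, c01, c00]
  · cases h : w φ <;> cases h' : w ψ <;> simp [hd, h, h', ofBool, d11, d10, d01, d00]

/-- Every valuation respecting a BNM scheme is refined by a classical valuation. -/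
theorem BNM.exists_refinement {X : Scheme} (hX : BNM X) {v : Fml → V3} (hv : Respects X v) :
    ∃ w : Fml → Bool, RespectsCL w ∧ ∀ φ, infLe (v φ) (ofBool (w φ)) := by
  obtain ⟨hB, hMn, hMc, hMd⟩ := hX
  refine ⟨evalBool fun n => decide (v (.var n) = .one), respectsCL_evalBool _, fun φ => ?_⟩
  obtain ⟨hn, hc, hd⟩ :=
    hB.respects_ofBool (respectsCL_evalBool fun n => decide (v (.var n) = .one))
  beta_reduce at hn hc hd
  induction φ with
  | var n => cases h : v (.var n) <;> simp [infLe, evalBool, ofBool, h]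
  | neg φ ih => rw [hv.1, hn]; exact hMn _ _ ih
  | conj φ ψ ihφ ihψ => rw [hv.2.1, hc]; exact hMc _ _ _ _ ihφ ihψ
  | disj φ ψ ihφ ihψ => rw [hv.2.2, hd]; exact hMd _ _ _ _ ihφ ihψ

/-- Validity over a Boolean normal scheme implies classical validity, as long as the
standards classify the Boolean values classically. -/
theorem Valid.mem_CL {X : Scheme} (hX : BooleanNormal X) {x y : Set V3} (hx : V3.one ∈ x)
    (hy : V3.zero ∉ y) {I : Infer} (h : Valid X x y I) : I ∈ CL := by
  intro w hw hΓ
  have hφ := h _ (hX.respects_ofBool hw) fun γ hγ => by simpa [hΓ γ hγ, ofBool] using hx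
  cases hc : w I.concl with
  | true => rfl
  | false => exact absurd (by simpa [hc, ofBool] using hφ) hy

theorem mem_tStd_iff {a : V3} : a ∈ tStd ↔ a ≠ .zero := by
  cases a <;> simp [tStd]

theorem SS_subset_CL {X : Scheme} (hX : BooleanNormal X) : SS X ⊆ CL :=
  fun _ h => Valid.mem_CL hX (by simp [sStd]) (by simp [sStd]) h

theorem TT_subset_CL {X : Scheme} (hX : BooleanNormal X) : TT X ⊆ CL :=
  fun _ h => Valid.mem_CL hX (by simp [tStd]) (by simp [tStd]) h

/-- Strict-tolerant consequence over any BNM scheme is classical consequence. -/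
theorem ST_eq_CL {X : Scheme} (hX : BNM X) : ST X = CL := by
  refine Set.Subset.antisymm
    (fun _ h => Valid.mem_CL hX.1 (by simp [sStd]) (by simp [tStd]) h) fun I hI v hv hΓ => ?_
  obtain ⟨w, hw, hle⟩ := hX.exists_refinement hv
  have hφ : w I.concl = true := hI w hw fun γ hγ => by
    have h1 : v γ = .one := hΓ γ hγ
    have h2 := hle γ
    cases h : w γ <;> simp [h1, h, infLe, ofBool] at h2 ⊢
  rw [mem_tStd_iff]
  intro h0
  have h2 := hle I.concl
  simp [h0, hφ, infLe, ofBool] at h2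

theorem transClosed_CL : TransClosed CL :=
  fun _ _ _ _ hφ hΔ w hw hΓ => hφ w hw fun δ hδ => hΔ δ hδ w hw hΓ

/-- Classical tautologies are tolerantly valid over every BNM scheme, from any premises. -/
theorem BNM.mem_TT_of_tautology {X : Scheme} (hX : BNM X) {φ : Fml}
    (h : ∀ w, RespectsCL w → w φ = true) (Γ : Finset Fml) : (⟨Γ, φ⟩ : Infer) ∈ TT X := by
  intro v hv _
  obtain ⟨w, hw, hle⟩ := hX.exists_refinement hv
  rw [mem_tStd_iff]
  intro h0
  have h2 := hle φ
  simp [show v φ = .zero from h0, h w hw, infLe, ofBool] at h2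

theorem RespectsCL.imps_eq_true {w : Fml → Bool} (hw : RespectsCL w) {l : List Fml} {φ : Fml}
    (h : (∀ γ ∈ l, w γ = true) → w φ = true) : w (imps l φ) = true := by
  induction l with
  | nil => exact h (by simp)
  | cons γ l ih =>
    change w (.disj (.neg γ) (imps l φ)) = true
    rw [hw.2.2, hw.1]
    cases hγ : w γ with
    | false => rfl
    | true => simpa using ih fun hl => h (by simpa [hγ] using hl)

/-- In a BNM scheme a disjunction with a false left disjunct is true only if the right
disjunct is. -/
theorem BNM.eq_one_of_fdisj_zero {X : Scheme} (hX : BNM X) {a : V3}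
    (h : X.fdisj .zero a = .one) : a = .one := by
  obtain ⟨⟨_, _, _, _, _, _, _, _, _, d00⟩, _, _, hMd⟩ := hX
  cases a with
  | one => rfl
  | zero => simp [d00] at h
  | half =>
    have h1 := hMd .zero .half .zero .zero (Or.inr rfl) (Or.inl rfl)
    simp [h, d00, infLe] at h1

/-- Strict truth is closed under modus ponens in every BNM scheme. -/
theorem BNM.eq_one_of_imps {X : Scheme} (hX : BNM X) {v : Fml → V3} (hv : Respects X v)
    {l : List Fml} {φ : Fml} (hl : ∀ γ ∈ l, v γ = .one) (h : v (imps l φ) = .one) :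
    v φ = .one := by
  induction l with
  | nil => exact h
  | cons γ l ih =>
    change v (.disj (.neg γ) (imps l φ)) = .one at h
    rw [hv.2.2, hv.1, hl γ (by simp), hX.1.2.1] at h
    exact ih (fun δ hδ => hl δ (by simp [hδ])) (hX.eq_one_of_fdisj_zero h)

/-- The transitive closure of the union of SS and TT is ST (over possibly
different BNM schemes). -/
theorem stmt8 : ∀ X X' X'' : Scheme, BNM X → BNM X' → BNM X'' →
    T (SS X ∪ TT X') = ST X'' := by
  intro X X' X'' hX hX' hX''
  rw [ST_eq_CL hX'']
  apply Set.Subset.antisymm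
  · exact Set.sInter_subset_of_mem
      ⟨Set.union_subset (SS_subset_CL hX.1) (TT_subset_CL hX'.1), transClosed_CL⟩
  · rintro ⟨Γ, φ⟩ hI L ⟨hL, hT⟩
    refine hT Γ (insert (imps Γ.toList φ) Γ) φ (Finset.insert_nonempty _ _)
      (hL (Or.inl ?_)) fun δ hδ => ?_
    · intro v hv hΔ
      exact hX.eq_one_of_imps hv (l := Γ.toList)
        (fun γ hγ => hΔ γ (Finset.mem_insert_of_mem (Finset.mem_toList.1 hγ)))
        (hΔ _ (Finset.mem_insert_self _ _))
    · rcases Finset.mem_insert.1 hδ with rfl | hδ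
      · exact hL (Or.inr (hX'.mem_TT_of_tautology
          (fun w hw => hw.imps_eq_true fun h => hI w hw (by simpa using h)) Γ))
      · exact hL (Or.inl fun v _ hΓ => hΓ δ hδ)

end ThreeValued
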